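/- Let K ⊆ ℝ^d be the attractor of a Euclidean IFS of similitudes, endowed with its natural fractal structure. If F satisfies the open set condition (OSC), then the order of the natural fractal structure is finite: there is N ∈ ℕ such that for every n ∈ ℕ and every x ∈ K the number of words 𝐢 ∈ Σ^n with x ∈ A_𝐢 is at most N. -/

import Mathlib

open scoped ENNReal

namespace IFSMoran

variable {X : Type*} [MetricSpace X]

/-- The map `f_i = f_{i1} o ... o f_{in}` associated to a word `i = i1...in`
(a list of indices). -/
def wMap {k : ℕ} (f : Fin k → X → X) : List (Fin k) → X → X
  | [] => id
  | i :: w => f i ∘ wMap f w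

/-- The piece `A_i = f_i(K)` of the natural fractal structure. -/
def piece {k : ℕ} (f : Fin k → X → X) (K : Set X) (w : List (Fin k)) : Set X :=
  wMap f w '' K

/-- The natural fractal structure (levels indexed by words) is irreducible:
no level admits a proper subcovering. -/
def Irred {k : ℕ} (f : Fin k → X → X) (K : Set X) : Prop :=
  ∀ w : List (Fin k),
    ¬ piece f K w ⊆ ⋃ v ∈ {v : List (Fin k) | v.length = w.length ∧ v ≠ w}, piece f K v

/-- `H³ₙˢ(K) = inf_{l ≥ n} ∑_{i ∈ Σˡ} diam (A_i) ^ s`. -/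
noncomputable def H3n {k : ℕ} (f : Fin k → X → X) (K : Set X) (s : ℝ) (n : ℕ) : ℝ≥0∞ :=
  ⨅ (l : ℕ) (_ : n ≤ l),
    ∑ w : Fin l → Fin k, EMetric.diam (piece f K (List.ofFn w)) ^ s

/-- `H³ˢ(K) = lim_n H³ₙˢ(K)`; the sequence is nondecreasing in `n`, so the limit
is the supremum. -/
noncomputable def H3 {k : ℕ} (f : Fin k → X → X) (K : Set X) (s : ℝ) : ℝ≥0∞ :=
  ⨆ n, H3n f K s n

/-- Fractal dimension III: `dim³(K) = inf {s ≥ 0 : H³ˢ(K) = 0}`. -/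
noncomputable def dim3 {k : ℕ} (f : Fin k → X → X) (K : Set X) : ℝ :=
  sInf {s : ℝ | 0 ≤ s ∧ H3 f K s = 0}

/-- `H⁴ₙˢ(K)`: infimum of `∑ diam (A_i) ^ s` over finite coverings of `K` by
pieces indexed by words of length `≥ n`. -/
noncomputable def H4n {k : ℕ} (f : Fin k → X → X) (K : Set X) (s : ℝ) (n : ℕ) : ℝ≥0∞ :=
  ⨅ (𝒜 : Finset (List (Fin k))) (_ : ∀ w ∈ 𝒜, n ≤ w.length)
      (_ : K ⊆ ⋃ w ∈ 𝒜, piece f K w),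
    ∑ w ∈ 𝒜, EMetric.diam (piece f K w) ^ s

/-- `H⁴ˢ(K) = lim_n H⁴ₙˢ(K)`; the sequence is nondecreasing in `n`, so the limit
is the supremum. -/
noncomputable def H4 {k : ℕ} (f : Fin k → X → X) (K : Set X) (s : ℝ) : ℝ≥0∞ :=
  ⨆ n, H4n f K s n

/-- Fractal dimension IV: `dim⁴(K) = inf {s ≥ 0 : H⁴ˢ(K) = 0}`. -/
noncomputable def dim4 {k : ℕ} (f : Fin k → X → X) (K : Set X) : ℝ :=
  sInf {s : ℝ | 0 ≤ s ∧ H4 f K s = 0}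

/-- Interior of `A` relative to `K` (as a subset of the ambient space `X`). -/
def intK (K A : Set X) : Set X := K \ closure (K \ A)

/-- The level separation property: interiors (in `K`) of two pieces indexed by
distinct words of the same length are disjoint (LSP1), and every piece has
nonempty interior in `K` (LSP2). -/
def LSP {k : ℕ} (f : Fin k → X → X) (K : Set X) : Prop :=
  (∀ v w : List (Fin k), v.length = w.length → v ≠ w →
      intK K (piece f K v) ∩ intK K (piece f K w) = ∅) ∧
  ∀ w : List (Fin k), (intK K (piece f K w)).Nonempty

/-- The natural fractal structure is a tiling: pieces indexed by distinct words
of the same length have disjoint interiors in `K`, and every piece is regularly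
closed in `K`, i.e. `cl_K (int_K (A_i)) = A_i`. -/
def IsTiling {k : ℕ} (f : Fin k → X → X) (K : Set X) : Prop :=
  (∀ v w : List (Fin k), v.length = w.length → v ≠ w →
      intK K (piece f K v) ∩ intK K (piece f K w) = ∅) ∧
  ∀ w : List (Fin k), closure (intK K (piece f K w)) ∩ K = piece f K w


/-- The contraction ratio `c_i = c_{i1} ⋯ c_{in}` of the map associated to a word. -/
def wRatio {k : ℕ} (c : Fin k → ℝ) (w : List (Fin k)) : ℝ := (w.map c).prod

lemma wRatio_append {k : ℕ} (c : Fin k → ℝ) (v w : List (Fin k)) :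
    wRatio c (v ++ w) = wRatio c v * wRatio c w := by
  simp [wRatio]

lemma wRatio_pos {k : ℕ} {c : Fin k → ℝ} (hc : ∀ i, 0 < c i) (w : List (Fin k)) :
    0 < wRatio c w := by
  induction w with
  | nil => simp [wRatio]
  | cons i w ih => simpa [wRatio] using mul_pos (hc i) ih

lemma wMap_append {Y : Type*} {k : ℕ} (f : Fin k → Y → Y) (v w : List (Fin k)) :
    wMap f (v ++ w) = wMap f v ∘ wMap f w := by
  induction v with
  | nil => rfl
  | cons i v ih => simp [wMap, ih, Function.comp_assoc]

lemma dist_wMap {Y : Type*} [MetricSpace Y] {k : ℕ} {f : Fin k → Y → Y} {c : Fin k → ℝ}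
    (hf : ∀ i x y, dist (f i x) (f i y) = c i * dist x y) (w : List (Fin k)) (x y : Y) :
    dist (wMap f w x) (wMap f w y) = wRatio c w * dist x y := by
  induction w with
  | nil => simp [wMap, wRatio]
  | cons i w ih =>
    simp only [wMap, Function.comp_apply, hf, ih, wRatio, List.map_cons, List.prod_cons]
    ring

lemma image_wMap_subset {Y : Type*} {k : ℕ} {f : Fin k → Y → Y} {V : Set Y}
    (hV : ∀ i, f i '' V ⊆ V) (w : List (Fin k)) : wMap f w '' V ⊆ V := by
  induction w with
  | nil => simp [wMap]
  | cons i w ih =>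
    rw [wMap, Set.image_comp]
    exact (Set.image_mono ih).trans (hV i)

lemma disjoint_image_wMap {Y : Type*} {k : ℕ} {f : Fin k → Y → Y} {V : Set Y}
    (hinj : ∀ i, Function.Injective (f i)) (hV : ∀ i, f i '' V ⊆ V)
    (hdisj : ∀ i j, i ≠ j → Disjoint (f i '' V) (f j '' V)) :
    ∀ {v w : List (Fin k)}, v.length = w.length → v ≠ w →
      Disjoint (wMap f v '' V) (wMap f w '' V)
  | [], [], _, hne => absurd rfl hne
  | i :: v, j :: w, hlen, hne => by
    simp only [wMap, Set.image_comp]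
    rcases eq_or_ne i j with rfl | hij
    · rw [Set.disjoint_image_iff (hinj i)]
      exact disjoint_image_wMap hinj hV hdisj (by simpa using hlen) (by simpa using hne)
    · exact (hdisj i j hij).mono (Set.image_mono (image_wMap_subset hV v))
        (Set.image_mono (image_wMap_subset hV w))

/-- A similitude of a Euclidean space is surjective. -/
lemma surjective_of_dist_eq_mul {E : Type*} [NormedAddCommGroup E] [InnerProductSpace ℝ E]
    [FiniteDimensional ℝ E] {g : E → E} {r : ℝ} (hr : 0 < r)
    (hg : ∀ x y, dist (g x) (g y) = r * dist x y) : Function.Surjective g := by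
  have hiso : Isometry fun x => r⁻¹ • g x := Isometry.of_dist_eq fun x y => by
    rw [dist_smul₀, hg, norm_inv, Real.norm_of_nonneg hr.le, inv_mul_cancel_left₀ hr.ne']
  let φ := hiso.affineIsometryOfStrictConvexSpace
  have hφ : Function.Surjective φ.linear :=
    LinearMap.injective_iff_surjective.mp φ.linearIsometry.injective
  intro y
  obtain ⟨x, hx⟩ := (AffineMap.linear_surjective_iff φ.toAffineMap).mp hφ (r⁻¹ • y)
  exact ⟨x, smul_right_injective E (inv_ne_zero hr.ne') hx⟩

/-- A word whose piece contains `x` extends to a word of prescribed comparable ratio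
whose piece still contains `x`. -/
lemma exists_extension {Y : Type*} {k : ℕ} {f : Fin k → Y → Y} [MetricSpace Y] {K : Set Y}
    (hK : K = ⋃ i, f i '' K) {c : Fin k → ℝ} (hc : ∀ i, 0 < c i) {a b r : ℝ}
    (ha : ∀ i, a ≤ c i) (hb : ∀ i, c i ≤ b) (hr : 0 < r) (hb0 : 0 ≤ b) {x : Y} (m : ℕ) :
    ∀ w : List (Fin k), r * a ≤ wRatio c w → wRatio c w * b ^ m ≤ r → x ∈ piece f K w →
      ∃ u, x ∈ piece f K (w ++ u) ∧ r * a ≤ wRatio c (w ++ u) ∧ wRatio c (w ++ u) ≤ r := by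
  induction m with
  | zero => exact fun w hw hwm hx => ⟨[], by simpa using ⟨hx, hw, by simpa using hwm⟩⟩
  | succ m ih =>
    intro w hw hwm hx
    rcases le_or_gt (wRatio c w) r with hle | hlt
    · exact ⟨[], by simpa using ⟨hx, hw, hle⟩⟩
    obtain ⟨z, hz, rfl⟩ := hx
    rw [hK, Set.mem_iUnion] at hz
    obtain ⟨i, y, hy, rfl⟩ := hz
    have hi : wRatio c (w ++ [i]) = wRatio c w * c i := by simp [wRatio]
    have hwpos := wRatio_pos hc w
    obtain ⟨u, hu⟩ := ih (w ++ [i])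
      (by
        rw [hi]
        exact mul_le_mul_of_nonneg hlt.le (ha i) hr.le (hc i).le)
      (by
        rw [hi]
        calc wRatio c w * c i * b ^ m ≤ wRatio c w * b * b ^ m := by gcongr; exact hb i
          _ = wRatio c w * b ^ (m + 1) := by ring
          _ ≤ r := hwm)
      ⟨y, hy, by simp [wMap_append, wMap]⟩
    exact ⟨[i] ++ u, by simpa only [List.append_assoc] using hu⟩

theorem stmt_16 {d : ℕ} {k : ℕ} (hk : 2 ≤ k)
    (f : Fin k → EuclideanSpace ℝ (Fin d) → EuclideanSpace ℝ (Fin d)) (c : Fin k → ℝ)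
    (hc : ∀ i, c i ∈ Set.Ioo (0 : ℝ) 1)
    (hf : ∀ i x y, dist (f i x) (f i y) = c i * dist x y)
    (K : Set (EuclideanSpace ℝ (Fin d))) (hKne : K.Nonempty) (hKcp : IsCompact K)
    (hK : K = ⋃ i, f i '' K)
    (hOSC : ∃ V : Set (EuclideanSpace ℝ (Fin d)), V.Nonempty ∧ IsOpen V ∧
      (∀ i, f i '' V ⊆ V) ∧ ∀ i j, i ≠ j → Disjoint (f i '' V) (f j '' V)) :
    ∃ N : ℕ, ∀ (n : ℕ) (x : EuclideanSpace ℝ (Fin d)), x ∈ K →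
      Set.ncard {w : List (Fin k) | w.length = n ∧ x ∈ piece f K w} ≤ N := by
  obtain ⟨V, ⟨p, hp⟩, hVo, hVf, hVd⟩ := hOSC
  have hpos : ∀ i, 0 < c i := fun i => (hc i).1
  have : Nonempty (Fin k) := ⟨⟨0, by omega⟩⟩
  obtain ⟨imin, himin⟩ := Finite.exists_min c
  obtain ⟨imax, himax⟩ := Finite.exists_max c
  have hinj : ∀ i, Function.Injective (f i) := fun i x y hxy => by
    have h := hf i x y
    rw [hxy, dist_self] at h
    exact dist_eq_zero.mp ((mul_eq_zero.mp h.symm).resolve_left (hpos i).ne')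
  obtain ⟨ρ, hρ, hball⟩ := Metric.isOpen_iff.mp hVo p hp
  obtain ⟨C, hC⟩ := hKcp.isBounded.subset_closedBall p
  have hδ : 0 < c imin * ρ := mul_pos (hpos _) hρ
  obtain ⟨T, -, hTfin, hT⟩ :=
    (isCompact_closedBall (0 : EuclideanSpace ℝ (Fin d)) C).finite_cover_balls (half_pos hδ)
  refine ⟨T.ncard, fun n x _ => ?_⟩
  set S : Set (List (Fin k)) := {w | w.length = n ∧ x ∈ piece f K w} with hS
  have hSfin : S.Finite := (List.finite_length_eq (Fin k) n).subset fun w hw => hw.1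
  rcases S.eq_empty_or_nonempty with hS0 | hSne
  · simp [hS0]
  obtain ⟨w₀, -, hw₀⟩ := Set.exists_min_image S (wRatio c) hSfin hSne
  set r := wRatio c w₀
  have hr : 0 < r := wRatio_pos hpos w₀
  have hext : ∀ w ∈ S, ∃ u, x ∈ piece f K (w ++ u) ∧ r * c imin ≤ wRatio c (w ++ u) ∧
      wRatio c (w ++ u) ≤ r := by
    intro w hw
    have hwpos := wRatio_pos hpos w
    obtain ⟨m, hm⟩ := exists_pow_lt_of_lt_one (div_pos hr hwpos) (hc imax).2
    refine exists_extension hK hpos himin himax hr (hpos imax).le m w ?_ ?_ hw.2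
    · exact (mul_le_of_le_one_right hr.le (hc imin).2.le).trans (hw₀ w hw)
    · rw [mul_comm]
      exact ((lt_div_iff₀ hwpos).mp hm).le
  choose! u hux hul hur using hext
  let y : List (Fin k) → EuclideanSpace ℝ (Fin d) := fun w => r⁻¹ • (wMap f (w ++ u w) p - x)
  have hy : ∀ w ∈ S, ∃ t ∈ T, dist (y w) t < c imin * ρ / 2 := by
    intro w hw
    have hmem : y w ∈ Metric.closedBall (0 : EuclideanSpace ℝ (Fin d)) C := by
      obtain ⟨z, hz, hzx⟩ := hux w hw
      have hzC : dist p z ≤ C := by simpa [dist_comm] using hC hz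
      rw [mem_closedBall_zero_iff, norm_smul, norm_inv, Real.norm_of_nonneg hr.le, ← hzx,
        ← dist_eq_norm, dist_wMap hf, inv_mul_le_iff₀ hr]
      exact mul_le_mul (hur w hw) hzC dist_nonneg hr.le
    simpa using hT hmem
  choose! t htT ht using hy
  refine Set.ncard_le_ncard_of_injOn t htT (fun w hw w' hw' heq => ?_) hTfin
  by_contra hne
  have hyd : dist (y w) (y w') < c imin * ρ := by
    have h := ht w' hw'
    rw [← heq] at h
    linarith [dist_triangle_right (y w) (y w') (t w), ht w hw]
  have hd : dist (wMap f (w' ++ u w') p) (wMap f (w ++ u w) p) <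
      wRatio c (w ++ u w) * ρ := by
    rw [dist_smul₀, norm_inv, Real.norm_of_nonneg hr.le, dist_sub_right,
      inv_mul_lt_iff₀ hr, dist_comm] at hyd
    calc _ < r * (c imin * ρ) := hyd
      _ = r * c imin * ρ := by ring
      _ ≤ _ := by gcongr; exact hul w hw
  have hRpos := wRatio_pos hpos (w ++ u w)
  obtain ⟨q, hq⟩ := surjective_of_dist_eq_mul hRpos (dist_wMap hf (w ++ u w))
    (wMap f (w' ++ u w') p)
  rw [← hq, dist_wMap hf, mul_lt_mul_iff_right₀ hRpos] at hd
  refine (disjoint_image_wMap hinj hVf hVd (hw.1.trans hw'.1.symm) hne).ne_of_mem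
    (a := wMap f (w' ++ u w') p) (b := wMap f (w' ++ u w') p) ?_ ?_ rfl
  · rw [← hq, wMap_append]
    exact ⟨_, image_wMap_subset hVf _ ⟨q, hball hd, rfl⟩, rfl⟩
  · rw [wMap_append]
    exact ⟨_, image_wMap_subset hVf _ ⟨p, hp, rfl⟩, rfl⟩

end IFSMoran
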